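/- For all q ∈ ℕ, the perfect matching graph PM_q satisfies gc(PM_q) ≥ q. -/

import Mathlib

open Matrix

def GCFeasible {V : Type*} [Fintype V] (A : Matrix V V ℝ) (m : ℕ) : Prop :=
  ∃ (k : ℕ) (P : Matrix (Fin k) V ℝ) (w : Fin k → ℝ),
    (∀ p i, P p i = 1 ∨ P p i = -1) ∧
    (∀ i, A i i = 0) ∧
    (∀ i j, i ≠ j → A i j = (Pᵀ * Matrix.diagonal w * P) i j) ∧
    m = (Finset.univ.filter fun p => w p ≠ 0).card

noncomputable def gc {V : Type*} [Fintype V] (A : Matrix V V ℝ) : ℕ :=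
  sInf { m | GCFeasible A m }

open scoped Classical in
noncomputable def gcGraph {V : Type*} [Fintype V] (G : SimpleGraph V) : ℕ :=
  gc (Matrix.of fun u v => if G.Adj u v then (1 : ℝ) else 0)

/-- The perfect matching graph PM_q on 2q vertices: vertex 2i is matched to 2i+1. -/
def perfectMatchingGraph (q : ℕ) : SimpleGraph (Fin (2 * q)) :=
  SimpleGraph.fromRel fun u v => u.val / 2 = v.val / 2

/-- A sign representation indexed by an arbitrary finite type witnesses feasibility. -/
lemma GCFeasible.of_fintype {V ι : Type*} [Fintype V] [Fintype ι] {A : Matrix V V ℝ}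
    (P : ι → V → ℝ) (w : ι → ℝ) (hP : ∀ p i, P p i = 1 ∨ P p i = -1) (hA : ∀ i, A i i = 0)
    (h : ∀ i j, i ≠ j → A i j = ∑ p, w p * (P p i * P p j)) :
    ∃ m, GCFeasible A m := by
  let e := Fintype.equivFin ι
  refine ⟨_, Fintype.card ι, Matrix.of fun p => P (e.symm p), fun p => w (e.symm p),
    fun p i => hP _ i, hA, fun i j hij => ?_, rfl⟩
  rw [h i j hij, Matrix.mul_apply, ← e.symm.sum_comp]
  refine Finset.sum_congr rfl fun p _ => ?_
  rw [Matrix.mul_diagonal, Matrix.transpose_apply, Matrix.of_apply, Matrix.of_apply]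
  ring

/-- Every symmetric matrix with zero diagonal has a graph coupling. -/
lemma exists_gcFeasible {V : Type*} [Fintype V] {A : Matrix V V ℝ}
    (hA : ∀ i, A i i = 0) (hsymm : ∀ i j, A i j = A j i) : ∃ m, GCFeasible A m := by
  classical
  let v : V → V → ℝ := fun a i => if a = i then -1 else 1
  refine GCFeasible.of_fintype (ι := (V × V) × Bool × Bool)
    (fun p i => (if p.2.1 then v p.1.1 i else 1) * (if p.2.2 then v p.1.2 i else 1))
    (fun p => A p.1.1 p.1.2 / 8 * ((if p.2.1 then -1 else 1) * (if p.2.2 then -1 else 1)))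
    (fun p i => ?_) hA fun i j hij => ?_
  · dsimp only [v]
    split_ifs <;> norm_num
  · have hv (a : V) : 1 - v a i * v a j = 2 * ((if a = i then 1 else 0) + if a = j then 1 else 0) := by
      dsimp only [v]
      split_ifs with h₁ h₂ <;> first | exact absurd (h₁.symm.trans h₂) hij | norm_num
    have hterm (a b : V) :
        (∑ s : Bool × Bool, A a b / 8 * ((if s.1 then -1 else 1) * (if s.2 then -1 else 1)) *
          (((if s.1 then v a i else 1) * (if s.2 then v b i else 1)) *
            ((if s.1 then v a j else 1) * (if s.2 then v b j else 1)))) =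
        A a b / 2 * (((if a = i then 1 else 0) + if a = j then 1 else 0) *
          ((if b = i then 1 else 0) + if b = j then 1 else 0)) := by
      simp only [Fintype.sum_prod_type, Fintype.sum_bool, if_true, Bool.false_eq_true, if_false]
      linear_combination A a b / 8 * (1 - v b i * v b j) * hv a +
        A a b / 4 * ((if a = i then 1 else 0) + if a = j then 1 else 0) * hv b
    rw [Fintype.sum_prod_type, Fintype.sum_prod_type]
    simp only [hterm, mul_add, add_mul, Finset.sum_add_distrib]
    simp [hA, hsymm j i]

/-- A feasible size bounds the order of any identity submatrix supported off the diagonal. -/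
lemma GCFeasible.card_le {V ι : Type*} [Fintype V] [Fintype ι] [DecidableEq ι]
    {A : Matrix V V ℝ} {m : ℕ} (h : GCFeasible A m) (r c : ι → V) (hrc : ∀ i j, r i ≠ c j)
    (hA : A.submatrix r c = 1) : Fintype.card ι ≤ m := by
  obtain ⟨k, P, w, -, -, hPA, rfl⟩ := h
  have hfac : (Pᵀ.submatrix r id * Matrix.diagonal w) * P.submatrix id c = 1 := by
    rw [← hA]
    ext i j
    exact (hPA _ _ (hrc i j)).symm
  calc Fintype.card ι = (1 : Matrix ι ι ℝ).rank := Matrix.rank_one.symm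
    _ ≤ (Pᵀ.submatrix r id * Matrix.diagonal w).rank := hfac ▸ Matrix.rank_mul_le_left _ _
    _ ≤ (Matrix.diagonal w).rank := Matrix.rank_mul_le_right _ _
    _ = (Finset.univ.filter fun p => w p ≠ 0).card := by
      rw [Matrix.rank_diagonal, Fintype.card_subtype]

/-- Corollary: gc(PM_q) ≥ q. -/
theorem pm_lower (q : ℕ) : q ≤ gcGraph (perfectMatchingGraph q) := by
  unfold gcGraph gc
  refine le_csInf (exists_gcFeasible (by simp) fun i j => ?_) fun m hm => ?_
  · simp only [Matrix.of_apply]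
    split_ifs with h₁ h₂ h₂ <;> first | rfl | exact absurd (SimpleGraph.Adj.symm ‹_›) ‹_›
  · simpa using hm.card_le (fun i : Fin q => ⟨2 * i, by omega⟩)
      (fun j : Fin q => ⟨2 * j + 1, by omega⟩)
      (fun i j h => by have := congrArg Fin.val h; dsimp only at this; omega) (by
        ext i j
        have hadj : (perfectMatchingGraph q).Adj ⟨2 * i, by omega⟩ ⟨2 * j + 1, by omega⟩ ↔
            i = j := by
          simp only [perfectMatchingGraph, SimpleGraph.fromRel_adj, ne_eq, Fin.ext_iff]
          omega
        simp [Matrix.one_apply, hadj])
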